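/- The gradient of the log-partition function f is Lipschitz continuous with constant λ_max(G)/2, where λ_max(G) is the largest eigenvalue of the Gram matrix G with entries G_{ij} = tr(A_i A_j); i.e., f is (λ_max(G)/2)-smooth on ℝ^m. -/

import Mathlib

open Matrix Filter
open scoped RealInnerProductSpace

/-- `A(y) = ∑ i, y i • A i`. -/
noncomputable def matA {n m : ℕ} (A : Fin m → Matrix (Fin n) (Fin n) ℝ)
    (y : EuclideanSpace ℝ (Fin m)) : Matrix (Fin n) (Fin n) ℝ :=
  ∑ i, y i • A i

/-- The log-partition function `f(y) = log tr exp A(y) - ⟨b, y⟩`. -/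
noncomputable def logPart {n m : ℕ} (A : Fin m → Matrix (Fin n) (Fin n) ℝ)
    (b : EuclideanSpace ℝ (Fin m)) (y : EuclideanSpace ℝ (Fin m)) : ℝ :=
  Real.log (Matrix.trace (NormedSpace.exp (matA A y))) - ⟪b, y⟫

/-- The linear map `𝒜(X) = (tr(A i * X))_i`. -/
noncomputable def Amap {n m : ℕ} (A : Fin m → Matrix (Fin n) (Fin n) ℝ)
    (X : Matrix (Fin n) (Fin n) ℝ) : EuclideanSpace ℝ (Fin m) :=
  WithLp.toLp 2 fun i => Matrix.trace (A i * X)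

/-- The spectraplex: symmetric PSD matrices of unit trace. -/
def spectraplex (n : ℕ) : Set (Matrix (Fin n) (Fin n) ℝ) :=
  {X | X.IsSymm ∧ X.PosSemidef ∧ X.trace = 1}

/-- The moment body `ℳ = 𝒜(spectraplex)`. -/
noncomputable def momentBody {n m : ℕ} (A : Fin m → Matrix (Fin n) (Fin n) ℝ) :
    Set (EuclideanSpace ℝ (Fin m)) :=
  Amap A '' spectraplex n

/-- The trace-normalized matrix exponential `X(y)`. -/
noncomputable def densityMat {n m : ℕ} (A : Fin m → Matrix (Fin n) (Fin n) ℝ)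
    (y : EuclideanSpace ℝ (Fin m)) : Matrix (Fin n) (Fin n) ℝ :=
  (Matrix.trace (NormedSpace.exp (matA A y)))⁻¹ • NormedSpace.exp (matA A y)

/-- The softmax map `a ↦ (exp (a i) / ∑ k, exp (a k))_i`. -/
noncomputable def softmax {ι : Type*} [Fintype ι] (a : ι → ℝ) (i : ι) : ℝ :=
  Real.exp (a i) / ∑ k, Real.exp (a k)

lemma sum_exp_pos {ι : Type*} [Fintype ι] [Nonempty ι] (a : ι → ℝ) :
    0 < ∑ k, Real.exp (a k) :=
  Finset.sum_pos (fun _ _ => Real.exp_pos _) Finset.univ_nonempty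

lemma softmax_nonneg {ι : Type*} [Fintype ι] (a : ι → ℝ) (i : ι) : 0 ≤ softmax a i := by
  unfold softmax; positivity

lemma sum_softmax {ι : Type*} [Fintype ι] [Nonempty ι] (a : ι → ℝ) : ∑ i, softmax a i = 1 := by
  unfold softmax
  rw [← Finset.sum_div, div_self (sum_exp_pos a).ne']

lemma softmax_comp_perm {ι : Type*} [Fintype ι] (a : ι → ℝ) (σ : Equiv.Perm ι) (i : ι) :
    softmax (a ∘ σ) i = softmax a (σ i) := by
  simp [softmax, Equiv.sum_comp σ fun k => Real.exp (a k)]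

/-- The variance of `v` under a probability vector is at most half the squared Euclidean norm. -/
lemma variance_le_half_sum_sq {ι : Type*} [Fintype ι] {p : ι → ℝ} (hp : ∀ i, 0 ≤ p i)
    (hp1 : ∑ i, p i = 1) (v : ι → ℝ) :
    ∑ i, p i * v i ^ 2 - (∑ i, p i * v i) ^ 2 ≤ (∑ i, v i ^ 2) / 2 := by
  classical
  have cross : (∑ i, p i * v i ^ 2) - (∑ i, p i * v i) ^ 2
      = ∑ i, ∑ j, p i * p j * (v i - v j) ^ 2 / 2 := by
    have h1 : ∑ i, ∑ j, p i * p j * (v i - v j) ^ 2 / 2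
        = ∑ i, ∑ j, ((p i * v i ^ 2) * p j / 2 + p i * (p j * v j ^ 2) / 2
          - (p i * v i) * (p j * v j)) :=
      Finset.sum_congr rfl fun i _ => Finset.sum_congr rfl fun j _ => by ring
    rw [h1]
    simp only [Finset.sum_sub_distrib, Finset.sum_add_distrib, ← Finset.sum_div,
      ← Finset.sum_mul_sum, hp1]
    ring
  have bound : ∀ i j, p i * p j * (v i - v j) ^ 2 / 2
      ≤ p i * p j * (v i ^ 2 + v j ^ 2) - if i = j then 2 * p i ^ 2 * v i ^ 2 else 0 := by
    intro i j
    split_ifs with h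
    · subst h; nlinarith
    · nlinarith [mul_nonneg (mul_nonneg (hp i) (hp j)) (sq_nonneg (v i + v j))]
  have total : ∑ i, ∑ j, (p i * p j * (v i ^ 2 + v j ^ 2)
      - if i = j then 2 * p i ^ 2 * v i ^ 2 else 0)
      = ∑ i, 2 * (p i * (1 - p i)) * v i ^ 2 := by
    have h1 : ∀ i j, p i * p j * (v i ^ 2 + v j ^ 2)
        = (p i * v i ^ 2) * p j + p i * (p j * v j ^ 2) := fun i j => by ring
    simp only [Finset.sum_sub_distrib, h1, Finset.sum_add_distrib, ← Finset.sum_mul_sum, hp1,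
      Finset.sum_ite_eq, Finset.mem_univ, if_true, mul_one, one_mul]
    rw [← Finset.sum_add_distrib, ← Finset.sum_sub_distrib]
    exact Finset.sum_congr rfl fun i _ => by ring
  rw [cross, Finset.sum_div]
  refine (Finset.sum_le_sum fun i _ => Finset.sum_le_sum fun j _ => bound i j).trans ?_
  rw [total]
  refine Finset.sum_le_sum fun i _ => ?_
  nlinarith [mul_nonneg (sq_nonneg (2 * p i - 1)) (sq_nonneg (v i))]

lemma covariance_le_quarter_sum_sq {ι : Type*} [Fintype ι] {p : ι → ℝ} (hp : ∀ i, 0 ≤ p i)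
    (hp1 : ∑ i, p i = 1) (h d : ι → ℝ) :
    ∑ i, p i * (h i * d i) - (∑ i, p i * h i) * ∑ i, p i * d i
      ≤ (∑ i, h i ^ 2 + ∑ i, d i ^ 2) / 4 := by
  have key := variance_le_half_sum_sq hp hp1 (fun i => h i + d i)
  have hneg : (∑ i, p i * (h i - d i)) ^ 2 ≤ ∑ i, p i * (h i - d i) ^ 2 := by
    simpa using (even_two.convexOn_pow).map_sum_le (t := Finset.univ) (w := p)
      (p := fun i => h i - d i) (fun i _ => hp i) hp1 (fun _ _ => Set.mem_univ _)
  have vh := variance_le_half_sum_sq hp hp1 h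
  have vd := variance_le_half_sum_sq hp hp1 d
  have e1 : ∑ i, p i * (h i - d i) = ∑ i, p i * h i - ∑ i, p i * d i := by
    rw [← Finset.sum_sub_distrib]; exact Finset.sum_congr rfl fun i _ => by ring
  have e2 : ∑ i, p i * (h i - d i) ^ 2
      = ∑ i, p i * h i ^ 2 + ∑ i, p i * d i ^ 2 - 2 * ∑ i, p i * (h i * d i) := by
    rw [Finset.mul_sum, ← Finset.sum_add_distrib, ← Finset.sum_sub_distrib]
    exact Finset.sum_congr rfl fun i _ => by ring
  rw [e1, e2] at hneg
  nlinarith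

lemma hasDerivAt_sum_mul_softmax {ι : Type*} [Fintype ι] [Nonempty ι] (a d h : ι → ℝ) (t : ℝ) :
    HasDerivAt (fun s : ℝ => ∑ i, softmax (a + s • d) i * h i)
      (∑ i, softmax (a + t • d) i * (h i * d i)
        - (∑ i, softmax (a + t • d) i * h i) * ∑ i, softmax (a + t • d) i * d i) t := by
  have hS := (sum_exp_pos (a + t • d)).ne'
  have hexp : ∀ i, HasDerivAt (fun s : ℝ => Real.exp ((a + s • d) i))
      (Real.exp ((a + t • d) i) * d i) t := fun i => by
    simpa using (((hasDerivAt_id t).mul_const (d i)).const_add (a i)).exp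
  have hsum : HasDerivAt (fun s : ℝ => ∑ k, Real.exp ((a + s • d) k))
      (∑ k, Real.exp ((a + t • d) k) * d k) t := HasDerivAt.fun_sum fun k _ => hexp k
  have hall := HasDerivAt.fun_sum (u := Finset.univ)
    fun i _ => ((hexp i).fun_div hsum hS).mul_const (h i)
  refine hall.congr_deriv ?_
  have hq : ∑ i, softmax (a + t • d) i * d i
      = (∑ k, Real.exp ((a + t • d) k) * d k) / ∑ k, Real.exp ((a + t • d) k) := by
    rw [Finset.sum_div]; exact Finset.sum_congr rfl fun i _ => by unfold softmax; ring
  rw [hq, Finset.sum_mul, ← Finset.sum_sub_distrib]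
  refine Finset.sum_congr rfl fun i _ => ?_
  unfold softmax
  field_simp

/-- Softmax is `1/2`-Lipschitz for the Euclidean norm. -/
lemma sum_sq_softmax_sub_le {ι : Type*} [Fintype ι] [Nonempty ι] (a c : ι → ℝ) :
    ∑ i, (softmax a i - softmax c i) ^ 2 ≤ (∑ i, (a i - c i) ^ 2) / 4 := by
  set d := a - c with hd
  set h : ι → ℝ := fun i => 2 * (softmax a i - softmax c i) with hh
  have hderiv := hasDerivAt_sum_mul_softmax c d h
  obtain ⟨t, -, ht⟩ := exists_hasDerivAt_eq_slope _ _ zero_lt_one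
    (fun s _ => (hderiv s).continuousAt.continuousWithinAt) (fun s _ => hderiv s)
  have hcov := covariance_le_quarter_sum_sq (softmax_nonneg (c + t • d))
    (sum_softmax (c + t • d)) h d
  rw [ht] at hcov
  have e1 : c + (1 : ℝ) • d = a := by simp [hd]
  have e0 : c + (0 : ℝ) • d = c := by simp
  have e2 : ∑ i, softmax a i * h i - ∑ i, softmax c i * h i
      = 2 * ∑ i, (softmax a i - softmax c i) ^ 2 := by
    rw [← Finset.sum_sub_distrib, Finset.mul_sum]
    exact Finset.sum_congr rfl fun i _ => by simp only [hh]; ring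
  have e3 : ∑ i, h i ^ 2 = 4 * ∑ i, (softmax a i - softmax c i) ^ 2 := by
    rw [Finset.mul_sum]
    exact Finset.sum_congr rfl fun i _ => by simp only [hh]; ring
  simp only [e1, e0, e2, e3, sub_zero, div_one] at hcov
  simp only [hd, Pi.sub_apply] at hcov
  linarith

/-- The coupled version of the Lipschitz bound for softmax, over a doubly stochastic coupling. -/
lemma sum_doublyStochastic_mul_sq_softmax_sub_le {ι : Type*} [Fintype ι] [DecidableEq ι]
    [Nonempty ι] {W : Matrix ι ι ℝ} (hW : W ∈ doublyStochastic ℝ ι) (a c : ι → ℝ) :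
    ∑ i, ∑ j, W i j * (softmax a i - softmax c j) ^ 2
      ≤ (∑ i, ∑ j, W i j * (a i - c j) ^ 2) / 4 := by
  obtain ⟨w, hw, -, rfl⟩ := exists_eq_sum_perm_of_mem_doublyStochastic hW
  have expand : ∀ g : ι → ι → ℝ,
      ∑ i, ∑ j, (∑ σ, w σ • σ.permMatrix ℝ) i j * g i j = ∑ σ, w σ * ∑ i, g i (σ i) := by
    intro g
    have hrow : ∀ i, ∑ j, (∑ σ, w σ • σ.permMatrix ℝ) i j * g i j = ∑ σ, w σ * g i (σ i) := by
      intro i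
      simp only [Matrix.sum_apply, Matrix.smul_apply, Finset.sum_mul, smul_eq_mul]
      rw [Finset.sum_comm]
      refine Finset.sum_congr rfl fun σ _ => ?_
      simp [Equiv.Perm.permMatrix, PEquiv.toMatrix_apply]
    simp only [hrow, Finset.mul_sum]
    exact Finset.sum_comm
  rw [expand, expand, Finset.sum_div]
  refine Finset.sum_le_sum fun σ _ => ?_
  have h := mul_le_mul_of_nonneg_left (sum_sq_softmax_sub_le a (c ∘ σ)) (hw σ)
  simp only [softmax_comp_perm, Function.comp_apply] at h
  linarith

/-- Simultaneous orthogonal diagonalization of a real symmetric matrix and its exponential. -/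
lemma exists_orthogonal_diagonal_exp {ι : Type*} [Fintype ι] [DecidableEq ι]
    {M : Matrix ι ι ℝ} (hM : M.IsHermitian) :
    ∃ U : Matrix ι ι ℝ, Uᵀ * U = 1 ∧ U * Uᵀ = 1 ∧ M = U * diagonal hM.eigenvalues * Uᵀ ∧
      NormedSpace.exp M = U * diagonal (fun i => Real.exp (hM.eigenvalues i)) * Uᵀ := by
  set U : Matrix ι ι ℝ := ↑hM.eigenvectorUnitary
  have h1 : Uᵀ * U = 1 := Unitary.coe_star_mul_self hM.eigenvectorUnitary
  have h2 : U * Uᵀ = 1 := Unitary.coe_mul_star_self hM.eigenvectorUnitary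
  have hdiag : M = U * diagonal hM.eigenvalues * Uᵀ := by
    conv_lhs => rw [hM.spectral_theorem, Unitary.conjStarAlgAut_apply]
    rfl
  refine ⟨U, h1, h2, hdiag, ?_⟩
  have hinv : U⁻¹ = Uᵀ := Matrix.inv_eq_right_inv h2
  conv_lhs => rw [hdiag, ← hinv]
  rw [Matrix.exp_conj U _ (IsUnit.of_mul_eq_one _ h2), Matrix.exp_diagonal, hinv]
  congr 3
  ext i
  rw [Pi.coe_exp, Real.exp_eq_exp_ℝ]

lemma trace_conj_diagonal {ι : Type*} [Fintype ι] [DecidableEq ι] {U : Matrix ι ι ℝ}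
    (hU : Uᵀ * U = 1) (a : ι → ℝ) : (U * diagonal a * Uᵀ).trace = ∑ i, a i := by
  rw [Matrix.trace_mul_comm, ← Matrix.mul_assoc, hU, Matrix.one_mul, Matrix.trace_diagonal]

lemma trace_conj_diagonal_mul {ι : Type*} [Fintype ι] [DecidableEq ι] (U V : Matrix ι ι ℝ)
    (a c : ι → ℝ) :
    ((U * diagonal a * Uᵀ) * (V * diagonal c * Vᵀ)).trace
      = ∑ i, ∑ j, (Uᵀ * V) i j ^ 2 * (a i * c j) := by
  have h : ((U * diagonal a * Uᵀ) * (V * diagonal c * Vᵀ)).trace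
      = (diagonal a * (Uᵀ * V) * (diagonal c * (Uᵀ * V)ᵀ)).trace := by
    rw [Matrix.transpose_mul, Matrix.transpose_transpose]
    simp only [Matrix.mul_assoc]
    rw [Matrix.trace_mul_comm]
    simp only [Matrix.mul_assoc]
  rw [h]
  simp only [Matrix.trace, Matrix.diag_apply, Matrix.mul_apply (M := diagonal a * (Uᵀ * V)),
    Matrix.diagonal_mul, Matrix.transpose_apply]
  exact Finset.sum_congr rfl fun i _ => Finset.sum_congr rfl fun j _ => by ring

lemma sq_entries_mem_doublyStochastic {ι : Type*} [Fintype ι] [DecidableEq ι]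
    {Q : Matrix ι ι ℝ} (h1 : Qᵀ * Q = 1) (h2 : Q * Qᵀ = 1) :
    (Matrix.of fun i j => Q i j ^ 2) ∈ doublyStochastic ℝ ι := by
  refine mem_doublyStochastic_iff_sum.2 ⟨fun i j => sq_nonneg _, fun i => ?_, fun j => ?_⟩
  · simpa [Matrix.mul_apply, sq] using congrFun₂ h2 i i
  · simpa [Matrix.mul_apply, sq] using congrFun₂ h1 j j

lemma sq_transpose_mul_mem_doublyStochastic {ι : Type*} [Fintype ι] [DecidableEq ι]
    {U V : Matrix ι ι ℝ} (hU : Uᵀ * U = 1) (hU' : U * Uᵀ = 1) (hV : Vᵀ * V = 1)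
    (hV' : V * Vᵀ = 1) :
    (Matrix.of fun i j => (Uᵀ * V) i j ^ 2) ∈ doublyStochastic ℝ ι := by
  apply sq_entries_mem_doublyStochastic
  · rw [Matrix.transpose_mul, Matrix.transpose_transpose, Matrix.mul_assoc,
      ← Matrix.mul_assoc U, hU', Matrix.one_mul, hV]
  · rw [Matrix.transpose_mul, Matrix.transpose_transpose, Matrix.mul_assoc,
      ← Matrix.mul_assoc V, hV', Matrix.one_mul, hU]

lemma trace_sq_conj_diagonal_sub {ι : Type*} [Fintype ι] [DecidableEq ι]
    {U V : Matrix ι ι ℝ} (hU : Uᵀ * U = 1) (hU' : U * Uᵀ = 1) (hV : Vᵀ * V = 1)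
    (hV' : V * Vᵀ = 1) (a c : ι → ℝ) :
    ((U * diagonal a * Uᵀ - V * diagonal c * Vᵀ)
      * (U * diagonal a * Uᵀ - V * diagonal c * Vᵀ)).trace
      = ∑ i, ∑ j, (Uᵀ * V) i j ^ 2 * (a i - c j) ^ 2 := by
  have hW := sq_transpose_mul_mem_doublyStochastic hU hU' hV hV'
  have hrow := sum_row_of_mem_doublyStochastic hW
  have hcol := sum_col_of_mem_doublyStochastic hW
  simp only [Matrix.of_apply] at hrow hcol
  have hself : ∀ {T : Matrix ι ι ℝ} (_ : Tᵀ * T = 1) (e : ι → ℝ),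
      ((T * diagonal e * Tᵀ) * (T * diagonal e * Tᵀ)).trace = ∑ i, e i ^ 2 := by
    intro T hT e
    rw [trace_conj_diagonal_mul, hT]
    simp [Matrix.one_apply, sq]
  have hA : ∑ i, ∑ j, (Uᵀ * V) i j ^ 2 * a i ^ 2 = ∑ i, a i ^ 2 := by
    simp only [← Finset.sum_mul, hrow, one_mul]
  have hC : ∑ i, ∑ j, (Uᵀ * V) i j ^ 2 * c j ^ 2 = ∑ i, c i ^ 2 := by
    rw [Finset.sum_comm]
    simp only [← Finset.sum_mul, hcol, one_mul]
  rw [Matrix.sub_mul, Matrix.mul_sub, Matrix.mul_sub]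
  simp only [Matrix.trace_sub]
  rw [Matrix.trace_mul_comm (V * diagonal c * Vᵀ) (U * diagonal a * Uᵀ), hself hU, hself hV,
    trace_conj_diagonal_mul, ← hA, ← hC]
  simp only [← Finset.sum_sub_distrib]
  exact Finset.sum_congr rfl fun i _ => Finset.sum_congr rfl fun j _ => by ring

/-- Klein's inequality for the exponential. -/
lemma trace_exp_add_trace_mul_le {ι : Type*} [Fintype ι] [DecidableEq ι]
    {M N : Matrix ι ι ℝ} (hM : M.IsHermitian) (hN : N.IsHermitian) :
    (NormedSpace.exp M).trace + (N * NormedSpace.exp M).trace - (M * NormedSpace.exp M).trace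
      ≤ (NormedSpace.exp N).trace := by
  obtain ⟨U, hU, hU', hMd, hMe⟩ := exists_orthogonal_diagonal_exp hM
  obtain ⟨V, hV, hV', hNd, hNe⟩ := exists_orthogonal_diagonal_exp hN
  set a := hM.eigenvalues
  set c := hN.eigenvalues
  have hW := sq_transpose_mul_mem_doublyStochastic hU hU' hV hV'
  have hrow := sum_row_of_mem_doublyStochastic hW
  have hcol := sum_col_of_mem_doublyStochastic hW
  simp only [Matrix.of_apply] at hrow hcol
  have t1 : (NormedSpace.exp M).trace = ∑ i, ∑ j, (Uᵀ * V) i j ^ 2 * Real.exp (a i) := by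
    rw [hMe, trace_conj_diagonal hU]
    simp only [← Finset.sum_mul, hrow, one_mul]
  have t2 : (NormedSpace.exp N).trace = ∑ i, ∑ j, (Uᵀ * V) i j ^ 2 * Real.exp (c j) := by
    rw [hNe, trace_conj_diagonal hV, Finset.sum_comm]
    simp only [← Finset.sum_mul, hcol, one_mul]
  have t3 : (N * NormedSpace.exp M).trace
      = ∑ i, ∑ j, (Uᵀ * V) i j ^ 2 * (Real.exp (a i) * c j) := by
    rw [Matrix.trace_mul_comm, hMe]
    conv_lhs => rw [hNd]
    rw [trace_conj_diagonal_mul]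
  have t4 : (M * NormedSpace.exp M).trace
      = ∑ i, ∑ j, (Uᵀ * V) i j ^ 2 * (a i * Real.exp (a i)) := by
    rw [hMe]
    conv_lhs => rw [hMd]
    rw [trace_conj_diagonal_mul, hU]
    simp only [← Finset.sum_mul, hrow, one_mul]
    simp [Matrix.one_apply]
  rw [t1, t2, t3, t4]
  simp only [← Finset.sum_sub_distrib, ← Finset.sum_add_distrib]
  refine Finset.sum_le_sum fun i _ => Finset.sum_le_sum fun j _ => ?_
  have hexp : Real.exp (a i) * (1 + (c j - a i)) ≤ Real.exp (c j) := by
    have h := mul_le_mul_of_nonneg_left (Real.add_one_le_exp (c j - a i)) (Real.exp_pos (a i)).le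
    rw [← Real.exp_add] at h
    simpa [add_comm] using h
  nlinarith [mul_le_mul_of_nonneg_left hexp (sq_nonneg ((Uᵀ * V) i j))]

/-- The trace-normalized matrix exponential is `1/2`-Lipschitz on symmetric matrices for the
Frobenius norm. -/
lemma trace_sq_normalized_exp_sub_le {ι : Type*} [Fintype ι] [DecidableEq ι] [Nonempty ι]
    {M N : Matrix ι ι ℝ} (hM : M.IsHermitian) (hN : N.IsHermitian) :
    ((((NormedSpace.exp M).trace⁻¹ • NormedSpace.exp M)
        - ((NormedSpace.exp N).trace⁻¹ • NormedSpace.exp N))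
      * (((NormedSpace.exp M).trace⁻¹ • NormedSpace.exp M)
        - ((NormedSpace.exp N).trace⁻¹ • NormedSpace.exp N))).trace
      ≤ ((M - N) * (M - N)).trace / 4 := by
  obtain ⟨U, hU, hU', hMd, hMe⟩ := exists_orthogonal_diagonal_exp hM
  obtain ⟨V, hV, hV', hNd, hNe⟩ := exists_orthogonal_diagonal_exp hN
  have normalize : ∀ {T : Matrix ι ι ℝ} (_ : Tᵀ * T = 1) (e : ι → ℝ),
      (T * diagonal (fun i => Real.exp (e i)) * Tᵀ).trace⁻¹
        • (T * diagonal (fun i => Real.exp (e i)) * Tᵀ) = T * diagonal (softmax e) * Tᵀ := by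
    intro T hT e
    rw [trace_conj_diagonal hT, ← Matrix.smul_mul, ← Matrix.mul_smul, ← Matrix.diagonal_smul]
    congr 3
    ext i
    simp [softmax, div_eq_inv_mul]
  rw [hMe, hNe, normalize hU, normalize hV, trace_sq_conj_diagonal_sub hU hU' hV hV']
  set a := hM.eigenvalues
  set c := hN.eigenvalues
  rw [hMd, hNd, trace_sq_conj_diagonal_sub hU hU' hV hV']
  exact sum_doublyStochastic_mul_sq_softmax_sub_le
    (sq_transpose_mul_mem_doublyStochastic hU hU' hV hV') a c

lemma trace_mul_sq_le {ι : Type*} [Fintype ι] {H D : Matrix ι ι ℝ} (hH : H.IsHermitian)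
    (hD : D.IsHermitian) : (H * D).trace ^ 2 ≤ (H * H).trace * (D * D).trace := by
  have tr : ∀ {P Q : Matrix ι ι ℝ}, Q.IsHermitian →
      (P * Q).trace = ∑ x : ι × ι, P x.1 x.2 * Q x.1 x.2 := by
    intro P Q hQ
    rw [Fintype.sum_prod_type]
    refine Finset.sum_congr rfl fun i _ => ?_
    rw [Matrix.diag_apply, Matrix.mul_apply]
    exact Finset.sum_congr rfl fun j _ => by rw [show Q j i = Q i j by simpa using hQ.apply i j]
  rw [tr hD, tr hH, tr hD]
  simpa [sq] using Finset.sum_mul_sq_le_sq_mul_sq Finset.univ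
    (fun x : ι × ι => H x.1 x.2) (fun x => D x.1 x.2)

lemma dotProduct_mulVec_le_iSup_eigenvalues {ι : Type*} [Fintype ι] [DecidableEq ι]
    {G : Matrix ι ι ℝ} (hG : G.IsHermitian) (x : ι → ℝ) :
    x ⬝ᵥ (G *ᵥ x) ≤ (⨆ k, hG.eigenvalues k) * (x ⬝ᵥ x) := by
  obtain ⟨U, -, hU', hd, -⟩ := exists_orthogonal_diagonal_exp hG
  set L := ⨆ k, hG.eigenvalues k
  have hle : ∀ k, hG.eigenvalues k ≤ L := fun k => le_ciSup (Set.finite_range _).bddAbove k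
  have e1 : x ⬝ᵥ (G *ᵥ x) = ∑ k, hG.eigenvalues k * (Uᵀ *ᵥ x) k ^ 2 := by
    conv_lhs => rw [hd]
    rw [← Matrix.mulVec_mulVec, ← Matrix.mulVec_mulVec, Matrix.dotProduct_mulVec,
      ← Matrix.mulVec_transpose]
    simp only [dotProduct, Matrix.mulVec_diagonal]
    exact Finset.sum_congr rfl fun k _ => by ring
  have e2 : x ⬝ᵥ x = ∑ k, (Uᵀ *ᵥ x) k ^ 2 := by
    calc x ⬝ᵥ x = x ⬝ᵥ ((U * Uᵀ) *ᵥ x) := by rw [hU', Matrix.one_mulVec]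
      _ = _ := by
        rw [← Matrix.mulVec_mulVec, Matrix.dotProduct_mulVec, ← Matrix.mulVec_transpose]
        simp only [dotProduct, sq]
  rw [e1, e2, Finset.mul_sum]
  exact Finset.sum_le_sum fun k _ => mul_le_mul_of_nonneg_right (hle k) (sq_nonneg _)

section LogPartition

variable {n m : ℕ} {A : Fin m → Matrix (Fin n) (Fin n) ℝ}

lemma isHermitian_matA (hA : ∀ i, (A i)ᵀ = A i) (y : EuclideanSpace ℝ (Fin m)) :
    (matA A y).IsHermitian := by
  simp [Matrix.IsHermitian, matA, Matrix.transpose_sum, hA]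

lemma matA_sub (y z : EuclideanSpace ℝ (Fin m)) : matA A (y - z) = matA A y - matA A z := by
  simp [matA, sub_smul, Finset.sum_sub_distrib]

lemma trace_matA_mul (y : EuclideanSpace ℝ (Fin m)) (X : Matrix (Fin n) (Fin n) ℝ) :
    (matA A y * X).trace = ⟪Amap A X, y⟫ := by
  simp [matA, Amap, Finset.sum_mul, Matrix.trace_sum, PiLp.inner_apply]

lemma Amap_sub (X Y : Matrix (Fin n) (Fin n) ℝ) : Amap A (X - Y) = Amap A X - Amap A Y := by
  ext i
  simp [Amap, Matrix.mul_sub]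

lemma Amap_smul (c : ℝ) (X : Matrix (Fin n) (Fin n) ℝ) : Amap A (c • X) = c • Amap A X := by
  ext i
  simp [Amap]

lemma trace_matA_mul_self {G : Matrix (Fin m) (Fin m) ℝ}
    (hG : ∀ i j, G i j = Matrix.trace (A i * A j)) (y : EuclideanSpace ℝ (Fin m)) :
    (matA A y * matA A y).trace = y.ofLp ⬝ᵥ (G *ᵥ y.ofLp) := by
  simp only [matA, Finset.sum_mul, Finset.mul_sum, Matrix.trace_sum, dotProduct, Matrix.mulVec,
    Matrix.smul_mul, Matrix.mul_smul, Matrix.trace_smul, smul_eq_mul, hG]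
  rw [Finset.sum_comm]
  exact Finset.sum_congr rfl fun i _ => Finset.sum_congr rfl fun j _ => by ring

lemma differentiable_trace_exp_matA :
    Differentiable ℝ fun y : EuclideanSpace ℝ (Fin m) => (NormedSpace.exp (matA A y)).trace := by
  let _ : NormedRing (Matrix (Fin n) (Fin n) ℝ) := Matrix.linftyOpNormedRing
  let _ : NormedAlgebra ℝ (Matrix (Fin n) (Fin n) ℝ) := Matrix.linftyOpNormedAlgebra
  have hexp : Differentiable ℝ (NormedSpace.exp : Matrix (Fin n) (Fin n) ℝ → _) :=
    fun x => (NormedSpace.exp_analytic (𝕂 := ℝ) x).differentiableAt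
  have hlin : Differentiable ℝ (matA A) := by
    unfold matA
    fun_prop
  exact (LinearMap.toContinuousLinearMap
    (Matrix.traceLinearMap (Fin n) ℝ ℝ)).differentiable.comp (hexp.comp hlin)

lemma hasFDerivAt_trace_exp_matA (hA : ∀ i, (A i)ᵀ = A i) (y : EuclideanSpace ℝ (Fin m)) :
    HasFDerivAt (fun z => (NormedSpace.exp (matA A z)).trace)
      (innerSL ℝ (Amap A (NormedSpace.exp (matA A y)))) y := by
  set ℓ := innerSL ℝ (Amap A (NormedSpace.exp (matA A y))) with hℓ
  have hF := (differentiable_trace_exp_matA (A := A) y).hasFDerivAt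
  have hmin : IsLocalMin (fun z => (NormedSpace.exp (matA A z)).trace - ℓ z) y := by
    refine Filter.Eventually.of_forall fun z => ?_
    have h := trace_exp_add_trace_mul_le (isHermitian_matA hA y) (isHermitian_matA hA z)
    simp only [trace_matA_mul] at h
    simp only [hℓ, innerSL_apply_apply]
    linarith
  have h0 := hmin.hasFDerivAt_eq_zero (hF.sub ℓ.hasFDerivAt)
  rwa [sub_eq_zero.1 h0] at hF

lemma gradient_logPart [Nonempty (Fin n)] (hA : ∀ i, (A i)ᵀ = A i)
    (b y : EuclideanSpace ℝ (Fin m)) :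
    gradient (logPart A b) y = Amap A (densityMat A y) - b := by
  have hpos : 0 < (NormedSpace.exp (matA A y)).trace := by
    obtain ⟨U, hU, -, -, he⟩ := exists_orthogonal_diagonal_exp (isHermitian_matA hA y)
    rw [he, trace_conj_diagonal hU]
    exact sum_exp_pos _
  refine HasGradientAt.gradient (hasGradientAt_iff_hasFDerivAt.2 ?_)
  have h := ((hasFDerivAt_trace_exp_matA hA y).log hpos.ne').sub (innerSL ℝ b).hasFDerivAt
  refine h.congr_fderiv ?_
  ext z
  simp [densityMat, Amap_smul]

end LogPartition

/-- the gradient of f is Lipschitz with constant λ_max(G)/2. -/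
theorem stmt7 (n m : ℕ) (hn : 1 ≤ n)
    (A : Fin m → Matrix (Fin n) (Fin n) ℝ) (hA : ∀ i, (A i)ᵀ = A i)
    (b : EuclideanSpace ℝ (Fin m))
    (G : Matrix (Fin m) (Fin m) ℝ)
    (hGdef : ∀ i j, G i j = Matrix.trace (A i * A j))
    (hG : G.IsHermitian) :
    ∀ y z : EuclideanSpace ℝ (Fin m),
      ‖gradient (logPart A b) y - gradient (logPart A b) z‖ ≤
        ((⨆ k, hG.eigenvalues k) / 2) * ‖y - z‖ := by
  intro y z
  have : Nonempty (Fin n) := ⟨⟨0, hn⟩⟩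
  set L := ⨆ k, hG.eigenvalues k
  have hsq : ∀ x : EuclideanSpace ℝ (Fin m), x.ofLp ⬝ᵥ x.ofLp = ‖x‖ ^ 2 := fun x => by
    rw [EuclideanSpace.real_norm_sq_eq]
    simp [dotProduct, sq]
  have hle : ∀ x : EuclideanSpace ℝ (Fin m), (matA A x * matA A x).trace ≤ L * ‖x‖ ^ 2 :=
    fun x => by
      rw [trace_matA_mul_self hGdef, ← hsq]
      exact dotProduct_mulVec_le_iSup_eigenvalues hG _
  have htr : ∀ {M : Matrix (Fin n) (Fin n) ℝ}, M.IsHermitian → 0 ≤ (M * M).trace := by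
    intro M hM
    have h := (Matrix.posSemidef_conjTranspose_mul_self M).trace_nonneg
    rwa [hM.eq] at h
  have hpsd : G.PosSemidef := .of_dotProduct_mulVec_nonneg hG fun x => by
    have h := trace_matA_mul_self hGdef (WithLp.toLp 2 x)
    simpa [← h] using htr (isHermitian_matA hA (WithLp.toLp 2 x))
  have hL : 0 ≤ L := Real.iSup_nonneg fun k => hpsd.eigenvalues_nonneg k
  have hdens : ∀ x, (densityMat A x).IsHermitian := fun x =>
    ((isHermitian_matA hA x).exp).smul (IsSelfAdjoint.all _)
  set D := densityMat A y - densityMat A z with hD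
  set v := Amap A D with hv
  have hgrad : gradient (logPart A b) y - gradient (logPart A b) z = v := by
    rw [gradient_logPart hA, gradient_logPart hA, hv, hD, Amap_sub]
    abel
  have hDle : (D * D).trace ≤ L * ‖y - z‖ ^ 2 / 4 := by
    refine (trace_sq_normalized_exp_sub_le (isHermitian_matA hA y)
      (isHermitian_matA hA z)).trans ?_
    rw [← matA_sub]
    linarith [hle (y - z)]
  have hcs := trace_mul_sq_le (isHermitian_matA hA v) ((hdens y).sub (hdens z))
  rw [← hD, trace_matA_mul, ← hv, real_inner_self_eq_norm_sq] at hcs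
  have hquartic : (‖v‖ ^ 2) ^ 2 ≤ (L * ‖v‖ ^ 2) * (L * ‖y - z‖ ^ 2 / 4) :=
    hcs.trans (mul_le_mul (hle v) hDle (htr ((hdens y).sub (hdens z))) (by positivity))
  rw [hgrad]
  rcases (norm_nonneg v).eq_or_lt with h0 | hvpos
  · rw [← h0]; positivity
  · refine (sq_le_sq₀ (norm_nonneg v) (by positivity)).1 ?_
    refine le_of_mul_le_mul_left ?_ (pow_pos hvpos 2)
    linarith
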